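/- arXiv:2512.06119 — 9 statements merged into one kernel-verified Lean document; each statement's English description precedes it below -/
import Mathlib

section
/- Let n ≥ 1, let p1, p2 : Fin n → ℕ be processing times, and let σ be a permutation of Fin n. Define completion times of a permutation schedule recursively by C1(0) = p1(σ(0)), C1(m) = C1(m−1) + p1(σ(m)) for m ≥ 1, C2(0) = C1(0) + p2(σ(0)), and C2(m) = max(C2(m−1), C1(m)) + p2(σ(m)) for m ≥ 1. Then the completion time of the last job on the second machine satisfies C2(n−1) = max over k ∈ Fin n of ( ∑_{i ≤ k} p1(σ(i)) + ∑_{i ≥ k} p2(σ(i)) ). -/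
lemma Fin.Iic_mk_succ {n m : ℕ} (hm : m + 1 < n) :
    Finset.Iic (⟨m + 1, hm⟩ : Fin n) =
      insert ⟨m + 1, hm⟩ (Finset.Iic ⟨m, Nat.lt_of_succ_lt hm⟩) := by
  ext i
  simp only [Finset.mem_Iic, Finset.mem_insert, Fin.le_def, Fin.ext_iff]
  omega

lemma Fin.Icc_mk_succ {n m : ℕ} (hm : m + 1 < n) {k : Fin n} (hk : k ≤ ⟨m + 1, hm⟩) :
    Finset.Icc k ⟨m + 1, hm⟩ =
      insert ⟨m + 1, hm⟩ (Finset.Icc k ⟨m, Nat.lt_of_succ_lt hm⟩) := by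
  ext i
  simp only [Finset.mem_Icc, Finset.mem_insert, Fin.le_def, Fin.ext_iff] at hk ⊢
  omega

lemma Fin.sum_Iic_mk_succ {n m : ℕ} (hm : m + 1 < n) (f : Fin n → ℕ) :
    ∑ i ∈ Finset.Iic (⟨m + 1, hm⟩ : Fin n), f i =
      ∑ i ∈ Finset.Iic (⟨m, Nat.lt_of_succ_lt hm⟩ : Fin n), f i + f ⟨m + 1, hm⟩ := by
  rw [Fin.Iic_mk_succ, Finset.sum_insert (by simp [Fin.le_def]), add_comm]

lemma Fin.sum_Icc_mk_succ {n m : ℕ} (hm : m + 1 < n) {k : Fin n} (hk : k ≤ ⟨m + 1, hm⟩)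
    (f : Fin n → ℕ) :
    ∑ i ∈ Finset.Icc k ⟨m + 1, hm⟩, f i =
      ∑ i ∈ Finset.Icc k ⟨m, Nat.lt_of_succ_lt hm⟩, f i + f ⟨m + 1, hm⟩ := by
  rw [Fin.Icc_mk_succ hm hk, Finset.sum_insert (by simp [Fin.le_def]), add_comm]

/-- Two-machine flow shop: the completion time on machine 2 of the last job of a
permutation schedule, defined by the usual recursion, equals
`max_k ( ∑_{i ≤ k} p1(σ i) + ∑_{i ≥ k} p2(σ i) )`. -/
theorem flowshop_completion_eq_sup
    (n : ℕ) (hn : 0 < n) (p1 p2 : Fin n → ℕ) (σ : Equiv.Perm (Fin n))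
    (C1 C2 : Fin n → ℕ)
    (hC10 : C1 ⟨0, hn⟩ = p1 (σ ⟨0, hn⟩))
    (hC1s : ∀ (m : ℕ) (hm : m + 1 < n),
      C1 ⟨m + 1, hm⟩ = C1 ⟨m, Nat.lt_of_succ_lt hm⟩ + p1 (σ ⟨m + 1, hm⟩))
    (hC20 : C2 ⟨0, hn⟩ = C1 ⟨0, hn⟩ + p2 (σ ⟨0, hn⟩))
    (hC2s : ∀ (m : ℕ) (hm : m + 1 < n),
      C2 ⟨m + 1, hm⟩ = max (C2 ⟨m, Nat.lt_of_succ_lt hm⟩) (C1 ⟨m + 1, hm⟩) + p2 (σ ⟨m + 1, hm⟩)) :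
    C2 ⟨n - 1, Nat.sub_lt hn Nat.one_pos⟩ =
      Finset.univ.sup
        (fun k : Fin n => (∑ i ∈ Finset.Iic k, p1 (σ i)) + ∑ i ∈ Finset.Ici k, p2 (σ i)) := by
  have Iic_zero : Finset.Iic (⟨0, hn⟩ : Fin n) = {⟨0, hn⟩} := by
    ext i
    simp [Fin.le_def, Fin.ext_iff]
  have C1_eq_sum : ∀ (m : ℕ) (hm : m < n), C1 ⟨m, hm⟩ = ∑ i ∈ Finset.Iic ⟨m, hm⟩, p1 (σ i) := by
    intro m
    induction m with
    | zero => intro _; rw [hC10, Iic_zero, Finset.sum_singleton]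
    | succ m ih =>
      intro hm
      rw [hC1s, ih, Fin.sum_Iic_mk_succ hm (fun i => p1 (σ i))]
  have C2_isGreatest : ∀ (m : ℕ) (hm : m < n), IsGreatest
      ((fun k => ∑ i ∈ Finset.Iic k, p1 (σ i) + ∑ i ∈ Finset.Icc k ⟨m, hm⟩, p2 (σ i)) ''
        Set.Iic ⟨m, hm⟩) (C2 ⟨m, hm⟩) := by
    intro m
    induction m with
    | zero =>
      intro _
      have hset : Set.Iic (⟨0, hn⟩ : Fin n) = {⟨0, hn⟩} := by
        rw [← Finset.coe_Iic, Iic_zero, Finset.coe_singleton]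
      rw [hset, Set.image_singleton, hC20, hC10, Iic_zero, Finset.Icc_self,
        Finset.sum_singleton, Finset.sum_singleton]
      exact isGreatest_singleton
    | succ m ih =>
      intro hm
      obtain ⟨⟨k, hk, hkC⟩, hub⟩ := ih (Nat.lt_of_succ_lt hm)
      have hle : (⟨m, Nat.lt_of_succ_lt hm⟩ : Fin n) ≤ ⟨m + 1, hm⟩ := by simp [Fin.le_def]
      rw [hC2s, C1_eq_sum]
      constructor
      · rcases le_total (C2 ⟨m, Nat.lt_of_succ_lt hm⟩)
          (∑ i ∈ Finset.Iic (⟨m + 1, hm⟩ : Fin n), p1 (σ i)) with h | h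
        · exact ⟨⟨m + 1, hm⟩, Set.self_mem_Iic, by simp [max_eq_right h]⟩
        · refine ⟨k, le_trans hk hle, ?_⟩
          dsimp only at hkC ⊢
          rw [max_eq_left h, ← hkC,
            Fin.sum_Icc_mk_succ hm (le_trans hk hle) (fun i => p2 (σ i)), add_assoc]
      · rintro _ ⟨j, hj, rfl⟩
        rcases eq_or_lt_of_le (Set.mem_Iic.mp hj) with rfl | hlt
        · simp
        · have hjm : j ≤ ⟨m, Nat.lt_of_succ_lt hm⟩ := Nat.lt_succ_iff.mp hlt
          have hjC := hub ⟨j, hjm, rfl⟩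
          dsimp only at hjC ⊢
          rw [Fin.sum_Icc_mk_succ hm hj (fun i => p2 (σ i)), ← add_assoc]
          exact Nat.add_le_add_right (hjC.trans (le_max_left _ _)) _
  have le_last : ∀ i : Fin n, i ≤ ⟨n - 1, Nat.sub_lt hn Nat.one_pos⟩ :=
    fun i => Nat.le_sub_one_of_lt i.isLt
  have Icc_last : ∀ k : Fin n,
      Finset.Icc k ⟨n - 1, Nat.sub_lt hn Nat.one_pos⟩ = Finset.Ici k := by
    intro k
    ext i
    simp [le_last i]
  obtain ⟨⟨k, -, hkC⟩, hub⟩ := C2_isGreatest (n - 1) (Nat.sub_lt hn Nat.one_pos)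
  simp only [Icc_last] at hkC hub
  apply le_antisymm
  · rw [← hkC]
    exact Finset.le_sup (f := fun k : Fin n =>
      (∑ i ∈ Finset.Iic k, p1 (σ i)) + ∑ i ∈ Finset.Ici k, p2 (σ i)) (Finset.mem_univ k)
  · exact Finset.sup_le fun j _ => hub ⟨j, le_last j, rfl⟩
end

section
/- Let n ≥ 1 and p1, p2 : Fin n → ℕ. Suppose a permutation σ of Fin n satisfies Johnson's condition: for all positions i ≤ j, min(p1(σ(i)), p2(σ(j))) ≤ min(p1(σ(j)), p2(σ(i))). Then for every permutation π of Fin n, Cmax(σ) ≤ Cmax(π); i.e., any sequence that first schedules the jobs with p1 ≤ p2 in nondecreasing order of p1 and then the jobs with p1 > p2 in nonincreasing order of p2 minimizes the makespan over all permutation schedules. -/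
/-- Makespan of a permutation schedule in the two-machine flow shop. -/
def Cmax (n : ℕ) (p1 p2 : Fin n → ℕ) (σ : Equiv.Perm (Fin n)) : ℕ :=
  Finset.univ.sup
    (fun k : Fin n => (∑ i ∈ Finset.Iic k, p1 (σ i)) + ∑ i ∈ Finset.Ici k, p2 (σ i))

open Finset

/-- Length of the critical path through job `c`, when job `j` occupies position `s j`. -/
def pathLength {J ι : Type*} [Fintype J] [LinearOrder ι] (p1 p2 : J → ℕ) (s : J → ι) (c : J) : ℕ :=
  ∑ j, ((if s j ≤ s c then p1 j else 0) + (if s c ≤ s j then p2 j else 0))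

/-- If every job up to `c` has `p1 ≤ p2` in a Johnson schedule `s`, then any other schedule `t` has
a critical path at least as long as the one of `s` through `c`. The path through the `t`-first job
`m` with `p1 c ≤ p1 m` works. -/
lemma exists_pathLength_le_of_forall_le {J ι : Type*} [Fintype J] [LinearOrder ι]
    {p1 p2 : J → ℕ} {s t : J → ι} (hs : Function.Injective s) (ht : Function.Injective t)
    (hJ : ∀ a b, s a ≤ s b → min (p1 a) (p2 b) ≤ min (p1 b) (p2 a)) {c : J}
    (hc : ∀ a, s a ≤ s c → p1 a ≤ p2 a) :
    ∃ m, pathLength p1 p2 s c ≤ pathLength p1 p2 t m := by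
  classical
  obtain ⟨m, hm, hmin⟩ := exists_min_image {j | p1 c ≤ p1 j} t ⟨c, by simp⟩
  simp only [mem_filter, mem_univ, true_and] at hm hmin
  refine ⟨m, ?_⟩
  have key : ∀ j ∈ univ, ((if s j ≤ s c then p1 j else 0) + (if s c ≤ s j then p2 j else 0)) +
        (if j = m then p1 c else 0) ≤
      ((if t j ≤ t m then p1 j else 0) + (if t m ≤ t j then p2 j else 0)) +
        (if j = c then p1 c else 0) := by
    intro j _
    have hs_cj : s j = s c → j = c := fun h => hs h
    have ht_mj : t j = t m → j = m := fun h => ht h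
    have hA := hc j
    have hB := hJ c j
    have hM := hmin j
    rcases lt_trichotomy (s j) (s c) with h | h | h <;>
    rcases lt_trichotomy (t j) (t m) with h' | h' | h' <;>
    grind
  have := sum_le_sum key
  simp only [sum_add_distrib, sum_ite_eq', mem_univ, if_true] at this
  simp only [pathLength, sum_add_distrib]
  omega

lemma pathLength_toDual {J ι : Type*} [Fintype J] [LinearOrder ι] (p1 p2 : J → ℕ) (s : J → ι)
    (c : J) : pathLength p2 p1 (OrderDual.toDual ∘ s) c = pathLength p1 p2 s c :=
  sum_congr rfl fun _ _ => add_comm _ _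

lemma exists_pathLength_le {J ι : Type*} [Fintype J] [LinearOrder ι]
    {p1 p2 : J → ℕ} {s t : J → ι} (hs : Function.Injective s) (ht : Function.Injective t)
    (hJ : ∀ a b, s a ≤ s b → min (p1 a) (p2 b) ≤ min (p1 b) (p2 a)) (c : J) :
    ∃ m, pathLength p1 p2 s c ≤ pathLength p1 p2 t m := by
  by_cases hc : ∀ a, s a ≤ s c → p1 a ≤ p2 a
  · exact exists_pathLength_le_of_forall_le hs ht hJ hc
  · push Not at hc
    obtain ⟨a, hac, ha⟩ := hc
    have hdual : ∀ b, s c ≤ s b → p2 b ≤ p1 b := fun b hb => by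
      have := hJ a b (hac.trans hb)
      omega
    obtain ⟨m, hm⟩ := exists_pathLength_le_of_forall_le (p1 := p2) (p2 := p1)
      (OrderDual.toDual.injective.comp hs) (OrderDual.toDual.injective.comp ht)
      (fun a b hab => by
        have := hJ b a hab
        rwa [min_comm (p2 a), min_comm (p2 b)]) (c := c) hdual
    exact ⟨m, by simpa only [pathLength_toDual] using hm⟩

lemma sum_Iic_add_sum_Ici_eq_pathLength {n : ℕ} (p1 p2 : Fin n → ℕ) (σ : Equiv.Perm (Fin n))
    (k : Fin n) :
    (∑ i ∈ Iic k, p1 (σ i)) + ∑ i ∈ Ici k, p2 (σ i) = pathLength p1 p2 σ.symm (σ k) := by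
  rw [pathLength, ← Equiv.sum_comp σ]
  simp only [Equiv.symm_apply_apply, sum_add_distrib, ← sum_filter]
  congr 2 <;> ext <;> simp

/-- Johnson's rule: any permutation satisfying Johnson's pairwise condition
minimizes the makespan in the two-machine flow shop. -/
theorem johnson_rule_optimal
    (n : ℕ) (hn : 0 < n) (p1 p2 : Fin n → ℕ) (σ : Equiv.Perm (Fin n))
    (hJ : ∀ i j : Fin n, i ≤ j →
      min (p1 (σ i)) (p2 (σ j)) ≤ min (p1 (σ j)) (p2 (σ i))) :
    ∀ π : Equiv.Perm (Fin n), Cmax n p1 p2 σ ≤ Cmax n p1 p2 π := by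
  intro π
  refine Finset.sup_le fun k _ => ?_
  obtain ⟨m, hm⟩ := exists_pathLength_le (p1 := p1) (p2 := p2) σ.symm.injective π.symm.injective
    (fun a b hab => by simpa using hJ _ _ hab) (σ k)
  rw [sum_Iic_add_sum_Ici_eq_pathLength]
  refine hm.trans ?_
  rw [← π.apply_symm_apply m, ← sum_Iic_add_sum_Ici_eq_pathLength]
  exact le_sup (f := fun k => (∑ i ∈ Iic k, p1 (π i)) + ∑ i ∈ Ici k, p2 (π i))
    (mem_univ (π.symm m))
end

section
/- No-idle lemma: let n ≥ 1, p1, p2 : Fin n → ℕ, and let σ be a permutation of Fin n. If for every position m ≥ 1 one has ∑_{i ≤ m} p1(σ(i)) ≤ ∑_{i ≤ m−1} p2(σ(i)) + p1(σ(0)), i.e. each job finishes on M1 no later than its predecessor finishes on M2, then the makespan equals p1(σ(0)) + ∑_{j} p2(j); in particular the critical index in the makespan formula is k = 0. -/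
/-- No-idle lemma: if every job finishes on machine 1 no later than its
predecessor finishes on machine 2 (no idle time is ever induced on machine 2),
then the makespan equals `p1(σ 0) + ∑_j p2 j`. -/
theorem flowshop_no_idle
    (n : ℕ) (hn : 0 < n) (p1 p2 : Fin n → ℕ) (σ : Equiv.Perm (Fin n))
    (hnoidle : ∀ m : Fin n, 0 < m.val →
      ∑ i ∈ Finset.Iic m, p1 (σ i) ≤ (∑ i ∈ Finset.Iio m, p2 (σ i)) + p1 (σ ⟨0, hn⟩)) :
    Finset.univ.sup
        (fun k : Fin n => (∑ i ∈ Finset.Iic k, p1 (σ i)) + ∑ i ∈ Finset.Ici k, p2 (σ i)) =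
      p1 (σ ⟨0, hn⟩) + ∑ j, p2 j := by
  have split (k : Fin n) :
      ∑ i ∈ Finset.Iio k, p2 (σ i) + ∑ i ∈ Finset.Ici k, p2 (σ i) = ∑ j, p2 j := by
    have hdisj : Disjoint (Finset.Iio k) (Finset.Ici k) :=
      Finset.disjoint_left.2 fun i hi hk =>
        (Finset.mem_Iio.1 hi).not_ge (Finset.mem_Ici.1 hk)
    have hunion : Finset.Iio k ∪ Finset.Ici k = Finset.univ := by
      ext i
      simp [lt_or_ge]
    rw [← Finset.sum_union hdisj, hunion, Equiv.sum_comp σ p2]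
  have first : ∑ i ∈ Finset.Iic (⟨0, hn⟩ : Fin n), p1 (σ i) = p1 (σ ⟨0, hn⟩) := by
    have hIic : Finset.Iic (⟨0, hn⟩ : Fin n) = {⟨0, hn⟩} := by
      ext i
      simp [Fin.le_def, Fin.ext_iff]
    rw [hIic, Finset.sum_singleton]
  have all : Finset.Ici (⟨0, hn⟩ : Fin n) = Finset.univ := by
    ext i
    simp [Fin.le_def]
  apply le_antisymm
  · refine Finset.sup_le fun k _ => ?_
    have hk : ∑ i ∈ Finset.Iic k, p1 (σ i) ≤
        (∑ i ∈ Finset.Iio k, p2 (σ i)) + p1 (σ ⟨0, hn⟩) := by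
      rcases Nat.eq_zero_or_pos k.val with h | h
      · obtain rfl : k = ⟨0, hn⟩ := Fin.ext h
        exact first.le.trans (Nat.le_add_left _ _)
      · exact hnoidle k h
    have := split k
    lia
  · refine le_trans (le_of_eq ?_) (Finset.le_sup (Finset.mem_univ (⟨0, hn⟩ : Fin n)))
    rw [first, all, Equiv.sum_comp σ p2]
end

section
/- Let n ≥ 1 and p1, p2 : Fin n → ℕ with p1(j) ≤ p2(j) for every job j, and let pmax1 = max_j p1(j). Suppose k < n − 1 satisfies ∑_{i ≤ k} p1(i) ≤ ∑_{i ≤ k} p2(i) − pmax1. Then for every permutation σ of Fin n that fixes each of the positions 0, …, k (i.e. σ(i) = i for i ≤ k) and for every position m ≥ k + 1, one has ∑_{i ≤ m} p1(σ(i)) ≤ ∑_{i ≤ m − 1} p2(σ(i)); consequently the critical index in the makespan formula for σ is at most k, i.e. Cmax(σ) = max over k' ≤ k of ( ∑_{i ≤ k'} p1(σ(i)) + ∑_{i ≥ k'} p2(σ(i)) ). -/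
/-- If all jobs satisfy `p1 ≤ p2` and the first `k+1` jobs accumulate an advance
of at least `pmax1 = max_j p1 j` of machine 2 over machine 1
(`∑_{i ≤ k} p1 i + pmax1 ≤ ∑_{i ≤ k} p2 i`), then for any permutation fixing
positions `0, …, k` no idle time occurs on machine 2 at positions `≥ k+1`, and
the critical index of the makespan formula is at most `k`. -/
theorem flowshop_partial_no_idle
    (n : ℕ) (hn : 0 < n) (p1 p2 : Fin n → ℕ)
    (hA : ∀ j, p1 j ≤ p2 j)
    (k : Fin n) (hk : k.val < n - 1)
    (hsum : (∑ i ∈ Finset.Iic k, p1 i) + Finset.univ.sup p1 ≤ ∑ i ∈ Finset.Iic k, p2 i)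
    (σ : Equiv.Perm (Fin n)) (hσ : ∀ i : Fin n, i ≤ k → σ i = i) :
    (∀ m : Fin n, k.val + 1 ≤ m.val →
        ∑ i ∈ Finset.Iic m, p1 (σ i) ≤ ∑ i ∈ Finset.Iio m, p2 (σ i)) ∧
      Finset.univ.sup
          (fun k' : Fin n => (∑ i ∈ Finset.Iic k', p1 (σ i)) + ∑ i ∈ Finset.Ici k', p2 (σ i)) =
        (Finset.Iic k).sup
          (fun k' : Fin n => (∑ i ∈ Finset.Iic k', p1 (σ i)) + ∑ i ∈ Finset.Ici k', p2 (σ i)) := by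
  have no_idle : ∀ m : Fin n, k.val + 1 ≤ m.val →
      ∑ i ∈ Finset.Iic m, p1 (σ i) ≤ ∑ i ∈ Finset.Iio m, p2 (σ i) := by
    intro m hm
    have hsub : Finset.Iic k ⊆ Finset.Iio m := fun i hi =>
      Finset.mem_Iio.2 ((Finset.mem_Iic.1 hi).trans_lt (Fin.lt_def.2 hm))
    have hfix (p : Fin n → ℕ) : ∑ i ∈ Finset.Iic k, p (σ i) = ∑ i ∈ Finset.Iic k, p i :=
      Finset.sum_congr rfl fun i hi => by rw [hσ i (Finset.mem_Iic.1 hi)]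
    have hrest : ∑ i ∈ Finset.Iio m \ Finset.Iic k, p1 (σ i) ≤
        ∑ i ∈ Finset.Iio m \ Finset.Iic k, p2 (σ i) :=
      Finset.sum_le_sum fun i _ => hA (σ i)
    have hmax : p1 (σ m) ≤ Finset.univ.sup p1 := Finset.le_sup (Finset.mem_univ _)
    rw [← Finset.Iio_insert, Finset.sum_insert (by simp), ← Finset.sum_sdiff hsub,
      ← Finset.sum_sdiff hsub, hfix p1, hfix p2]
    lia
  refine ⟨no_idle, le_antisymm (Finset.sup_le fun m _ => ?_)
    (Finset.sup_mono (Finset.subset_univ _))⟩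
  rcases le_or_gt m k with hmk | hkm
  · exact Finset.le_sup (f := fun k' : Fin n =>
      (∑ i ∈ Finset.Iic k', p1 (σ i)) + ∑ i ∈ Finset.Ici k', p2 (σ i)) (Finset.mem_Iic.2 hmk)
  · have hzero : ∀ i : Fin n, ⟨0, hn⟩ ≤ i := fun i => Fin.le_def.2 (Nat.zero_le _)
    have htotal : (∑ i ∈ Finset.Iio m, p2 (σ i)) + ∑ i ∈ Finset.Ici m, p2 (σ i) =
        ∑ i ∈ Finset.Ici ⟨0, hn⟩, p2 (σ i) := by
      rw [← Finset.sum_union (Finset.disjoint_left.2 fun i hi hi' =>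
        (Finset.mem_Iio.1 hi).not_ge (Finset.mem_Ici.1 hi'))]
      congr 1
      ext i
      simp [hzero i, lt_or_ge i m]
    calc (∑ i ∈ Finset.Iic m, p1 (σ i)) + ∑ i ∈ Finset.Ici m, p2 (σ i)
        ≤ (∑ i ∈ Finset.Iio m, p2 (σ i)) + ∑ i ∈ Finset.Ici m, p2 (σ i) :=
          Nat.add_le_add_right (no_idle m hkm) _
      _ ≤ (∑ i ∈ Finset.Iic ⟨0, hn⟩, p1 (σ i)) + ∑ i ∈ Finset.Ici ⟨0, hn⟩, p2 (σ i) :=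
          htotal.le.trans (Nat.le_add_left _ _)
      _ ≤ _ := Finset.le_sup (f := fun k' : Fin n =>
          (∑ i ∈ Finset.Iic k', p1 (σ i)) + ∑ i ∈ Finset.Ici k', p2 (σ i))
          (Finset.mem_Iic.2 (hzero k))
end

section
/- Property (partial sort of set A suffices): let n ≥ 1 and p1, p2 : Fin n → ℕ with p1(j) ≤ p2(j) for every job j (all jobs belong to Johnson's set A), with the jobs indexed so that p1 is nondecreasing (Johnson order), and let pmax1 = max_j p1(j). Suppose k < n − 1 satisfies ∑_{i ≤ k} p1(i) ≤ ∑_{i ≤ k} p2(i) − pmax1. Then for every permutation σ of Fin n with σ(i) = i for all i ≤ k (jobs 0, …, k first in sorted order, the remaining jobs in an arbitrary order), Cmax(σ) = Cmax(identity); in particular every such σ is an optimal schedule. -/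
/-- The term of position `m` in the makespan of `σ` is the total load of the second machine plus
the first operation at position `m`, minus the slacks `p2 - p1` of the jobs before `m`. -/
lemma makespan_term_add_slack {n : ℕ} {p1 p2 : Fin n → ℕ} (hA : ∀ j, p1 j ≤ p2 j)
    (σ : Equiv.Perm (Fin n)) (m : Fin n) :
    (∑ i ∈ Finset.Iic m, p1 (σ i)) + (∑ i ∈ Finset.Ici m, p2 (σ i)) +
      ∑ i ∈ Finset.Iio m, (p2 (σ i) - p1 (σ i)) = p1 (σ m) + ∑ j, p2 j := by
  have hIic : ∑ i ∈ Finset.Iic m, p1 (σ i) = p1 (σ m) + ∑ i ∈ Finset.Iio m, p1 (σ i) := by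
    rw [← Finset.Iio_insert, Finset.sum_insert (by simp)]
  have hslack : (∑ i ∈ Finset.Iio m, (p2 (σ i) - p1 (σ i))) + ∑ i ∈ Finset.Iio m, p1 (σ i) =
      ∑ i ∈ Finset.Iio m, p2 (σ i) := by
    rw [← Finset.sum_add_distrib]
    exact Finset.sum_congr rfl fun i _ => Nat.sub_add_cancel (hA _)
  have htotal : (∑ i ∈ Finset.Iio m, p2 (σ i)) + ∑ i ∈ Finset.Ici m, p2 (σ i) = ∑ j, p2 j := by
    rw [← Equiv.sum_comp σ p2, ← Finset.sum_add_sum_compl (Finset.Iio m)]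
    congr 2
    ext i
    simp
  omega

lemma makespan_term_le_Cmax {n : ℕ} (p1 p2 : Fin n → ℕ) (σ : Equiv.Perm (Fin n)) (m : Fin n) :
    (∑ i ∈ Finset.Iic m, p1 (σ i)) + ∑ i ∈ Finset.Ici m, p2 (σ i) ≤ Cmax n p1 p2 σ :=
  Finset.le_sup (f := fun k : Fin n =>
    (∑ i ∈ Finset.Iic k, p1 (σ i)) + ∑ i ∈ Finset.Ici k, p2 (σ i)) (Finset.mem_univ m)

lemma sum_le_Cmax {n : ℕ} (hn : 0 < n) {p1 p2 : Fin n → ℕ} (hA : ∀ j, p1 j ≤ p2 j)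
    (π : Equiv.Perm (Fin n)) : ∑ j, p2 j ≤ Cmax n p1 p2 π := by
  have hterm := makespan_term_add_slack hA π ⟨0, hn⟩
  have hempty : Finset.Iio (⟨0, hn⟩ : Fin n) = ∅ := by
    ext i
    simp [Fin.lt_def]
  rw [hempty, Finset.sum_empty] at hterm
  have := makespan_term_le_Cmax p1 p2 π ⟨0, hn⟩
  omega

/-- Every term of the makespan of the Johnson sequence bounds every makespan from below. -/
lemma johnson_term_le_Cmax {n : ℕ} {p1 p2 : Fin n → ℕ} (hA : ∀ j, p1 j ≤ p2 j)
    (hmono : Monotone p1) (π : Equiv.Perm (Fin n)) (m : Fin n) :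
    p1 m + ∑ j, p2 j ≤ Cmax n p1 p2 π + ∑ i ∈ Finset.Iio m, (p2 i - p1 i) := by
  obtain ⟨t, ht, hmin⟩ := Finset.exists_minimal (s := Finset.univ.filter fun i => m ≤ π i)
    ⟨π.symm m, by simp⟩
  have hmt : m ≤ π t := by simpa using ht
  have hbefore : ∀ i < t, π i < m := fun i hi => by
    by_contra h
    exact absurd (hmin (by simpa using h) hi.le) (not_le.mpr hi)
  have hslack : ∑ i ∈ Finset.Iio t, (p2 (π i) - p1 (π i)) ≤
      ∑ i ∈ Finset.Iio m, (p2 i - p1 i) := by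
    refine (Finset.sum_map (Finset.Iio t) π.toEmbedding fun j => p2 j - p1 j).symm.trans_le ?_
    refine Finset.sum_le_sum_of_subset fun j hj => ?_
    obtain ⟨i, hi, rfl⟩ := Finset.mem_map.mp hj
    exact Finset.mem_Iio.mpr (hbefore i (Finset.mem_Iio.mp hi))
  have hterm := makespan_term_add_slack hA π t
  have hle := makespan_term_le_Cmax p1 p2 π t
  have := hmono hmt
  omega

/-- A sequence starting with jobs `0, …, k`, whose total slack is at least `max p1`, is optimal. -/
lemma Cmax_le_of_fixes_prefix {n : ℕ} (hn : 0 < n) {p1 p2 : Fin n → ℕ}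
    (hA : ∀ j, p1 j ≤ p2 j) (hmono : Monotone p1) (k : Fin n)
    (hsum : (∑ i ∈ Finset.Iic k, p1 i) + Finset.univ.sup p1 ≤ ∑ i ∈ Finset.Iic k, p2 i)
    (σ : Equiv.Perm (Fin n)) (hσ : ∀ i : Fin n, i ≤ k → σ i = i) (π : Equiv.Perm (Fin n)) :
    Cmax n p1 p2 σ ≤ Cmax n p1 p2 π := by
  refine Finset.sup_le fun m _ => ?_
  have hterm := makespan_term_add_slack hA σ m
  rcases le_or_gt m k with hmk | hkm
  · have hslack : ∑ i ∈ Finset.Iio m, (p2 (σ i) - p1 (σ i)) =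
        ∑ i ∈ Finset.Iio m, (p2 i - p1 i) :=
      Finset.sum_congr rfl fun i hi => by
        rw [hσ i ((Finset.mem_Iio.mp hi).le.trans hmk)]
    rw [hσ m hmk, hslack] at hterm
    have := johnson_term_le_Cmax hA hmono π m
    omega
  · have hprefix : ∑ i ∈ Finset.Iic k, (p2 i - p1 i) ≤
        ∑ i ∈ Finset.Iio m, (p2 (σ i) - p1 (σ i)) := by
      calc ∑ i ∈ Finset.Iic k, (p2 i - p1 i)
          = ∑ i ∈ Finset.Iic k, (p2 (σ i) - p1 (σ i)) :=
            Finset.sum_congr rfl fun i hi => by rw [hσ i (Finset.mem_Iic.mp hi)]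
        _ ≤ ∑ i ∈ Finset.Iio m, (p2 (σ i) - p1 (σ i)) :=
            Finset.sum_le_sum_of_subset fun i hi =>
              Finset.mem_Iio.mpr ((Finset.mem_Iic.mp hi).trans_lt hkm)
    rw [Finset.sum_tsub_distrib _ fun i _ => hA i] at hprefix
    have hmax : p1 (σ m) ≤ Finset.univ.sup p1 := Finset.le_sup (Finset.mem_univ _)
    have := sum_le_Cmax hn hA π
    omega

/-- Partial sort of set A suffices: if all jobs belong to Johnson's set A
(`p1 j ≤ p2 j`), are indexed in nondecreasing order of `p1` (Johnson order),
and `∑_{i ≤ k} p1 i + pmax1 ≤ ∑_{i ≤ k} p2 i` where `pmax1 = max_j p1 j`, then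
every permutation fixing positions `0, …, k` (remaining jobs in arbitrary order)
has the same makespan as the identity (Johnson) sequence, and is optimal. -/
theorem flowshop_partial_sort_A
    (n : ℕ) (hn : 0 < n) (p1 p2 : Fin n → ℕ)
    (hA : ∀ j, p1 j ≤ p2 j)
    (hmono : Monotone p1)
    (k : Fin n) (hk : k.val < n - 1)
    (hsum : (∑ i ∈ Finset.Iic k, p1 i) + Finset.univ.sup p1 ≤ ∑ i ∈ Finset.Iic k, p2 i)
    (σ : Equiv.Perm (Fin n)) (hσ : ∀ i : Fin n, i ≤ k → σ i = i) :
    Cmax n p1 p2 σ = Cmax n p1 p2 1 ∧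
      ∀ π : Equiv.Perm (Fin n), Cmax n p1 p2 σ ≤ Cmax n p1 p2 π := by
  have hopt := Cmax_le_of_fixes_prefix hn hA hmono k hsum
  exact ⟨le_antisymm (hopt σ hσ 1) (hopt 1 (fun _ _ => rfl) σ), hopt σ hσ⟩
end

section
/- Let n ≥ 1 and p1, p2 : Fin n → ℕ, let A = {j : p1(j) ≤ p2(j)} and B = {j : p1(j) > p2(j)}, assume B is nonempty, and let pmaxB2 = max_{j ∈ B} p2(j). If ∑_j p1(j) ≤ ∑_j p2(j) − pmaxB2, then for every permutation σ that schedules all jobs of A before all jobs of B, the makespan satisfies Cmax(σ) = C2A(σ) + ∑_{j ∈ B} p2(j), where C2A(σ) denotes the completion time on machine M2 of the last A-job under σ (the makespan of the schedule restricted to the A-jobs in the order given by σ). In particular, Cmax(σ) does not depend on the order in which the jobs of B are sequenced. -/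
/-- Completion time on machine 2 of the last A-job, for a schedule σ placing the
`nA` jobs of set A in the first `nA` positions: the makespan of the schedule
restricted to the A-jobs in the order given by σ. -/
def C2A (n : ℕ) (p1 p2 : Fin n → ℕ) (nA : ℕ) (σ : Equiv.Perm (Fin n)) : ℕ :=
  (Finset.univ.filter (fun k : Fin n => k.val < nA)).sup
    (fun k : Fin n =>
      (∑ i ∈ Finset.Iic k, p1 (σ i)) +
        ∑ i ∈ Finset.univ.filter (fun i : Fin n => k ≤ i ∧ i.val < nA), p2 (σ i))

/-- If the positions after `k` hold jobs with `p2 ≤ p1`, the path through `k` is at most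
`∑ j, p1 j + p2 (σ k)`. -/
theorem path_le_sum_add {n : ℕ} (p1 p2 : Fin n → ℕ) (σ : Equiv.Perm (Fin n)) (k : Fin n)
    (h : ∀ i, k < i → p2 (σ i) ≤ p1 (σ i)) :
    (∑ i ∈ Finset.Iic k, p1 (σ i)) + ∑ i ∈ Finset.Ici k, p2 (σ i) ≤ (∑ j, p1 j) + p2 (σ k) := by
  have hsplit : ∑ j, p1 j = (∑ i ∈ Finset.Iic k, p1 (σ i)) + ∑ i ∈ Finset.Ioi k, p1 (σ i) := by
    rw [← Equiv.sum_comp σ p1, ← Finset.sum_add_sum_compl (Finset.Iic k)]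
    congr 2
    ext i
    simp
  have hIci : ∑ i ∈ Finset.Ici k, p2 (σ i) = p2 (σ k) + ∑ i ∈ Finset.Ioi k, p2 (σ i) := by
    rw [← Finset.Ioi_insert, Finset.sum_insert (by simp)]
  have hle : ∑ i ∈ Finset.Ioi k, p2 (σ i) ≤ ∑ i ∈ Finset.Ioi k, p1 (σ i) :=
    Finset.sum_le_sum fun i hi => h i (Finset.mem_Ioi.mp hi)
  omega

/-- A sum over the positions from `k` on splits at a position `m > k`. -/
theorem sum_Ici_eq_sum_lt_add_sum_ge {n : ℕ} (f : Fin n → ℕ) {k : Fin n} {m : ℕ}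
    (hk : k.val < m) :
    ∑ i ∈ Finset.Ici k, f i =
      (∑ i ∈ Finset.univ.filter (fun i : Fin n => k ≤ i ∧ i.val < m), f i) +
        ∑ i ∈ Finset.univ.filter (fun i : Fin n => m ≤ i.val), f i := by
  rw [← Finset.sum_filter_add_sum_filter_not (Finset.Ici k) (fun i => i.val < m)]
  congr 2
  · ext i
    simp
  · ext i
    simp only [Finset.mem_filter, Finset.mem_Ici, Finset.mem_univ, true_and, not_lt, Fin.le_def]
    omega

/-- If `∑_j p1 j ≤ ∑_j p2 j − pmaxB2` (with `pmaxB2 = max_{j ∈ B} p2 j`, `B`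
nonempty), then every permutation scheduling all jobs of `A = {j : p1 j ≤ p2 j}`
before all jobs of `B = {j : p1 j > p2 j}` has makespan equal to the completion
time of the last A-job on machine 2 plus `∑_{j ∈ B} p2 j`; in particular the
makespan does not depend on the order of the B-jobs. -/
theorem flowshop_A_before_B_makespan
    (n : ℕ) (hn : 0 < n) (p1 p2 : Fin n → ℕ)
    (hBne : (Finset.univ.filter (fun j : Fin n => p2 j < p1 j)).Nonempty)
    (hsum : (∑ j, p1 j) + (Finset.univ.filter (fun j : Fin n => p2 j < p1 j)).sup p2
      ≤ ∑ j, p2 j)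
    (σ : Equiv.Perm (Fin n))
    (hσ : ∀ i : Fin n,
      (σ i ∈ Finset.univ.filter (fun j : Fin n => p1 j ≤ p2 j) ↔
        i.val < (Finset.univ.filter (fun j : Fin n => p1 j ≤ p2 j)).card)) :
    Cmax n p1 p2 σ =
      C2A n p1 p2 (Finset.univ.filter (fun j : Fin n => p1 j ≤ p2 j)).card σ +
        ∑ j ∈ Finset.univ.filter (fun j : Fin n => p2 j < p1 j), p2 j := by
  set a := (Finset.univ.filter (fun j : Fin n => p1 j ≤ p2 j)).card
  have hB : ∀ i : Fin n, p2 (σ i) < p1 (σ i) ↔ a ≤ i.val := fun i => by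
    have := hσ i
    simp only [Finset.mem_filter, Finset.mem_univ, true_and] at this
    omega
  have hsumB : ∑ j ∈ Finset.univ.filter (fun j : Fin n => p2 j < p1 j), p2 j =
      ∑ i ∈ Finset.univ.filter (fun i : Fin n => a ≤ i.val), p2 (σ i) := by
    simp_rw [Finset.sum_filter, ← hB]
    exact (Equiv.sum_comp σ fun j => if p2 j < p1 j then p2 j else 0).symm
  have ha : 0 < a := by
    by_contra h0
    obtain ⟨j, hj⟩ := hBne
    have hlt : ∑ i, p2 i < ∑ i, p1 i := by
      refine Finset.sum_lt_sum_of_nonempty ⟨j, Finset.mem_univ j⟩ fun i _ => ?_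
      simpa using (hB (σ.symm i)).mpr (by omega)
    omega
  rw [hsumB]
  have hterm : ∀ k : Fin n, k.val < a → (∑ i ∈ Finset.Iic k, p1 (σ i)) +
      (∑ i ∈ Finset.univ.filter (fun i : Fin n => k ≤ i ∧ i.val < a), p2 (σ i)) ≤
        C2A n p1 p2 a σ := fun k hk =>
    Finset.le_sup (f := fun k : Fin n => (∑ i ∈ Finset.Iic k, p1 (σ i)) +
      ∑ i ∈ Finset.univ.filter (fun i : Fin n => k ≤ i ∧ i.val < a), p2 (σ i))
      (by simpa using hk)
  have hpath : ∀ k : Fin n, k.val < a →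
      (∑ i ∈ Finset.Iic k, p1 (σ i)) + ∑ i ∈ Finset.Ici k, p2 (σ i) ≤
        C2A n p1 p2 a σ +
          ∑ i ∈ Finset.univ.filter (fun i : Fin n => a ≤ i.val), p2 (σ i) := fun k hk => by
    have := hterm k hk
    rw [sum_Ici_eq_sum_lt_add_sum_ge (fun i => p2 (σ i)) hk]
    omega
  apply le_antisymm
  · refine Finset.sup_le fun k _ => ?_
    rcases lt_or_ge k.val a with hk | hk
    · exact hpath k hk
    · have hle := path_le_sum_add p1 p2 σ k fun i hi =>
        ((hB i).mpr (hk.trans (Fin.le_def.mp hi.le))).le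
      have hmax : p2 (σ k) ≤ (Finset.univ.filter (fun j : Fin n => p2 j < p1 j)).sup p2 :=
        Finset.le_sup (by simpa using (hB k).mpr hk)
      have hfirst := hpath ⟨0, hn⟩ ha
      have hIci : Finset.Ici (⟨0, hn⟩ : Fin n) = Finset.univ := by
        ext i
        simp [Fin.le_def]
      rw [hIci, Equiv.sum_comp σ p2] at hfirst
      omega
  · obtain ⟨k, hk, hkeq⟩ := Finset.exists_mem_eq_sup
      (Finset.univ.filter (fun k : Fin n => k.val < a)) ⟨⟨0, hn⟩, by simpa using ha⟩
      (fun k : Fin n => (∑ i ∈ Finset.Iic k, p1 (σ i)) +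
        ∑ i ∈ Finset.univ.filter (fun i : Fin n => k ≤ i ∧ i.val < a), p2 (σ i))
    have hka : k.val < a := by simpa using hk
    rw [C2A, hkeq, add_assoc, ← sum_Ici_eq_sum_lt_add_sum_ge (fun i => p2 (σ i)) hka]
    exact Finset.le_sup (f := fun k : Fin n => (∑ i ∈ Finset.Iic k, p1 (σ i)) +
      ∑ i ∈ Finset.Ici k, p2 (σ i)) (Finset.mem_univ k)
end

section
/- Property 5: let n ≥ 1 and p1, p2 : Fin n → ℕ, let A = {j : p1(j) ≤ p2(j)} and B = {j : p1(j) > p2(j)} with B nonempty, and let pmaxB2 = max_{j ∈ B} p2(j) and pmaxA1 = max_{j ∈ A} p1(j). Assume ∑_j p1(j) ≤ ∑_j p2(j) − pmaxB2. Index the A-jobs in nondecreasing order of p1 and suppose kA satisfies: the sum of p1 over the kA smallest-p1 jobs of A is at most the sum of p2 over those same jobs minus pmaxA1. Then every permutation σ that first schedules those kA jobs of A in nondecreasing order of p1, then the remaining jobs of A in an arbitrary order, and finally the jobs of B in an arbitrary order, attains the minimum makespan: Cmax(σ) ≤ Cmax(π) for every permutation π. -/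
/-- The term of position `k` in the makespan, written as total work on the second machine, plus the
first-machine time of the job at `k`, plus the surplus `p1 - p2` of the jobs scheduled before `k`. -/
lemma flowshop_term_eq {n : ℕ} (p1 p2 : Fin n → ℕ) (σ : Equiv.Perm (Fin n)) (k : Fin n) :
    (((∑ i ∈ Finset.Iic k, p1 (σ i)) + ∑ i ∈ Finset.Ici k, p2 (σ i) : ℕ) : ℤ) =
      (∑ j, (p2 j : ℤ)) + p1 (σ k) +
        ∑ j, if σ.symm j < k then (p1 j : ℤ) - p2 j else 0 := by
  have h1 : (∑ j, if σ.symm j < k then (p1 j : ℤ) - p2 j else 0) =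
      ∑ i, if i < k then (p1 (σ i) : ℤ) - p2 (σ i) else 0 := by
    rw [← Equiv.sum_comp σ]
    simp
  have h2 : (∑ i ∈ Finset.Iic k, (p1 (σ i) : ℤ)) = ∑ i, if i ≤ k then (p1 (σ i) : ℤ) else 0 := by
    rw [← Finset.sum_filter]
    congr 1
    ext
    simp
  have h3 : (∑ i ∈ Finset.Ici k, (p2 (σ i) : ℤ)) = ∑ i, if k ≤ i then (p2 (σ i) : ℤ) else 0 := by
    rw [← Finset.sum_filter]
    congr 1
    ext
    simp
  have h4 : (p1 (σ k) : ℤ) = ∑ i, if i = k then (p1 (σ i) : ℤ) else 0 := by simp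
  push_cast
  rw [h1, h2, h3, h4, ← Equiv.sum_comp σ (fun j => (p2 j : ℤ)), ← Finset.sum_add_distrib,
    ← Finset.sum_add_distrib, ← Finset.sum_add_distrib]
  refine Finset.sum_congr rfl fun i _ => ?_
  rcases lt_trichotomy i k with h | h | h
  · simp [h, h.le, h.ne, h.not_ge]
  · simp [h, add_comm]
  · simp [h.le, h.ne', h.not_ge, h.not_gt]

lemma flowshop_term_le_Cmax {n : ℕ} (p1 p2 : Fin n → ℕ) (π : Equiv.Perm (Fin n)) (k : Fin n) :
    (∑ i ∈ Finset.Iic k, p1 (π i)) + ∑ i ∈ Finset.Ici k, p2 (π i) ≤ Cmax n p1 p2 π :=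
  Finset.le_sup (f := fun k : Fin n =>
    (∑ i ∈ Finset.Iic k, p1 (π i)) + ∑ i ∈ Finset.Ici k, p2 (π i)) (Finset.mem_univ k)

lemma sum_second_le_Cmax {n : ℕ} (hn : 0 < n) (p1 p2 : Fin n → ℕ) (π : Equiv.Perm (Fin n)) :
    ∑ j, p2 j ≤ Cmax n p1 p2 π := by
  refine le_trans ?_ (flowshop_term_le_Cmax p1 p2 π ⟨0, hn⟩)
  have h : Finset.Ici (⟨0, hn⟩ : Fin n) = Finset.univ := by
    ext i
    simp [Fin.le_def]
  rw [h, Equiv.sum_comp π p2]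
  exact Nat.le_add_left _ _

/-- The term of an `A`-job in Johnson's order is a lower bound for every makespan: compare it with
the first `A`-job of index at least `k` scheduled by `π`. -/
lemma johnson_term_le_Cmax_s8 {n : ℕ} (p1 p2 : Fin n → ℕ) (nA : ℕ)
    (hidx : ∀ i : Fin n, i.val < nA ↔ p1 i ≤ p2 i)
    (hmonoA : ∀ i j : Fin n, i ≤ j → j.val < nA → p1 i ≤ p1 j)
    (k : Fin n) (hk : k.val < nA) (π : Equiv.Perm (Fin n)) :
    (∑ j, (p2 j : ℤ)) + p1 k + (∑ j, if j < k then (p1 j : ℤ) - p2 j else 0) ≤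
      Cmax n p1 p2 π := by
  obtain ⟨t, ⟨hkt, htA⟩, hmin⟩ := exists_minimal_of_wellFoundedLT
    (fun t : Fin n => k ≤ π t ∧ (π t).val < nA) ⟨π.symm k, by simpa using hk⟩
  have hterm := Int.ofNat_le.mpr (flowshop_term_le_Cmax p1 p2 π t)
  refine le_trans ?_ hterm
  rw [flowshop_term_eq]
  refine add_le_add (add_le_add le_rfl (mod_cast hmonoA k (π t) hkt htA))
    (Finset.sum_le_sum fun j _ => ?_)
  have hA := hidx j
  have hbefore : π.symm j < t → k ≤ j → ¬ j.val < nA := fun hlt hkj hjA =>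
    hlt.not_ge (hmin (y := π.symm j) (by simpa using ⟨hkj, hjA⟩) hlt.le)
  split_ifs with hjk hjt hjt
  · rfl
  · have : j.val < nA := lt_trans hjk hk
    omega
  · have := hbefore hjt (not_lt.mp hjk)
    omega
  · rfl

/-- Property 5: jobs are indexed so that Johnson's set `A = {j : p1 j ≤ p2 j}`
occupies the first `nA` indices, sorted in nondecreasing order of `p1`; `B` is
nonempty and `∑_j p1 j ≤ ∑_j p2 j − pmaxB2`. If the first `kA` jobs of `A`
satisfy `∑ p1 ≤ ∑ p2 − pmaxA1`, then every permutation scheduling first those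
`kA` jobs of `A` in nondecreasing order of `p1`, then the remaining jobs of `A`
in an arbitrary order, and finally the jobs of `B` in an arbitrary order,
attains the minimum makespan. -/
theorem flowshop_property5
    (n : ℕ) (hn : 0 < n) (p1 p2 : Fin n → ℕ)
    (nA : ℕ)
    (hidx : ∀ i : Fin n, i.val < nA ↔ p1 i ≤ p2 i)
    (hmonoA : ∀ i j : Fin n, i ≤ j → j.val < nA → p1 i ≤ p1 j)
    (hBne : ∃ j : Fin n, p2 j < p1 j)
    (hsum : (∑ j, p1 j) + (Finset.univ.filter (fun j : Fin n => p2 j < p1 j)).sup p2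
      ≤ ∑ j, p2 j)
    (kA : ℕ) (hkA : kA ≤ nA)
    (hkAsum : (∑ i ∈ Finset.univ.filter (fun i : Fin n => i.val < kA), p1 i)
        + (Finset.univ.filter (fun j : Fin n => p1 j ≤ p2 j)).sup p1
      ≤ ∑ i ∈ Finset.univ.filter (fun i : Fin n => i.val < kA), p2 i)
    (σ : Equiv.Perm (Fin n))
    (hσ1 : ∀ i : Fin n, i.val < kA → σ i = i)
    (hσ2 : ∀ i : Fin n, kA ≤ i.val → i.val < nA → kA ≤ (σ i).val ∧ (σ i).val < nA)
    (hσ3 : ∀ i : Fin n, nA ≤ i.val → nA ≤ (σ i).val) :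
    ∀ π : Equiv.Perm (Fin n), Cmax n p1 p2 σ ≤ Cmax n p1 p2 π := by
  intro π
  have hsymm : ∀ j : Fin n, j.val < kA → σ.symm j = j := fun j hj => by
    rw [Equiv.symm_apply_eq, hσ1 j hj]
  refine Finset.sup_le fun k _ => ?_
  rcases lt_or_ge k.val kA with hk | hk
  · have hjohnson := johnson_term_le_Cmax_s8 p1 p2 nA hidx hmonoA k (hk.trans_le hkA) π
    have hterm := flowshop_term_eq p1 p2 σ k
    have hpre : ∀ j, σ.symm j < k ↔ j < k := fun j => by
      constructor
      · intro h
        have hj := hσ1 (σ.symm j) (lt_trans h hk)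
        rw [Equiv.apply_symm_apply] at hj
        rwa [← hj] at h
      · intro h
        rwa [hsymm j (lt_trans h hk)]
    simp only [hpre, hσ1 k hk] at hterm
    exact Int.ofNat_le.mp (hterm.trans_le hjohnson)
  refine le_trans ?_ (sum_second_le_Cmax hn p1 p2 π)
  rcases lt_or_ge k.val nA with hkn | hkn
  · have hterm := flowshop_term_eq p1 p2 σ k
    have hmax : p1 (σ k) ≤ (Finset.univ.filter (fun j : Fin n => p1 j ≤ p2 j)).sup p1 :=
      Finset.le_sup (by simpa using (hidx _).mp (hσ2 k hk hkn).2)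
    have hpre : (∑ j, if σ.symm j < k then (p1 j : ℤ) - p2 j else 0) ≤
        ∑ j : Fin n, if j.val < kA then (p1 j : ℤ) - p2 j else 0 := by
      refine Finset.sum_le_sum fun j _ => ?_
      by_cases hj : j.val < kA
      · have : σ.symm j < k := by
          rw [hsymm j hj]
          exact Fin.lt_def.mpr (hj.trans_le hk)
        simp [hj, this]
      · rw [if_neg hj]
        split_ifs with hjk
        · have hA : j.val < nA := by
            rcases lt_or_ge (σ.symm j).val kA with h | h
            · have hfix := hσ1 _ h
              rw [Equiv.apply_symm_apply] at hfix
              rw [← hfix] at h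
              exact absurd h hj
            · simpa using (hσ2 _ h (lt_trans hjk hkn)).2
          have := (hidx j).mp hA
          omega
        · rfl
    have hsplit : (∑ j : Fin n, if j.val < kA then (p1 j : ℤ) - p2 j else 0) =
        ((∑ j ∈ Finset.univ.filter (fun j : Fin n => j.val < kA), p1 j : ℕ) : ℤ) -
          (∑ j ∈ Finset.univ.filter (fun j : Fin n => j.val < kA), p2 j : ℕ) := by
      rw [← Finset.sum_filter, Finset.sum_sub_distrib]
      push_cast
      rfl
    rw [← Nat.cast_sum] at hterm
    omega
  · have hB : ∀ i, k ≤ i → p2 (σ i) < p1 (σ i) := fun i hi => by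
      have h1 := hσ3 i (le_trans hkn hi)
      have h2 := hidx (σ i)
      omega
    have hmax : p2 (σ k) ≤ (Finset.univ.filter (fun j : Fin n => p2 j < p1 j)).sup p2 :=
      Finset.le_sup (by simpa using hB k le_rfl)
    have htail : ∑ i ∈ Finset.Ioi k, p2 (σ i) ≤ ∑ i ∈ Finset.Ioi k, p1 (σ i) :=
      Finset.sum_le_sum fun i hi => (hB i (Finset.mem_Ioi.mp hi).le).le
    have hIci : ∑ i ∈ Finset.Ici k, p2 (σ i) = p2 (σ k) + ∑ i ∈ Finset.Ioi k, p2 (σ i) := by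
      rw [← Finset.Ioi_insert, Finset.sum_insert (by simp)]
    have htotal : (∑ i ∈ Finset.Iic k, p1 (σ i)) + ∑ i ∈ Finset.Ioi k, p1 (σ i) = ∑ j, p1 j := by
      rw [← Equiv.sum_comp σ p1, ← Finset.sum_add_sum_compl (Finset.Iic k)]
      congr 2
      ext i
      simp
    omega
end

section
/- Worst-case family, optimal value: fix n ≥ 1 and consider the two-machine flow shop with 2n jobs where p1(j) = j and p2(j) = j + 1 for 1 ≤ j ≤ n, and p1(j) = 2n − j + 2 and p2(j) = 2n − j + 1 for n + 1 ≤ j ≤ 2n. Then the identity sequence 1, 2, …, 2n has makespan (n + 1)², and this is the minimum makespan: for every permutation π of the 2n jobs, Cmax(π) ≥ (n + 1)². -/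
/-- Processing time on machine 1 in the worst-case family: job `j = i + 1`
(1-indexed) has `p1 j = j` for `1 ≤ j ≤ n` and `p1 j = 2n − j + 2` for
`n + 1 ≤ j ≤ 2n`. -/
def wcP1 (n : ℕ) (i : Fin (2 * n)) : ℕ :=
  if i.val < n then i.val + 1 else 2 * n - i.val + 1

/-- Processing time on machine 2 in the worst-case family: job `j = i + 1`
(1-indexed) has `p2 j = j + 1` for `1 ≤ j ≤ n` and `p2 j = 2n − j + 1` for
`n + 1 ≤ j ≤ 2n`. -/
def wcP2 (n : ℕ) (i : Fin (2 * n)) : ℕ :=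
  if i.val < n then i.val + 2 else 2 * n - i.val

/-- The total load of machine 2. -/
theorem sum_wcP2 (n : ℕ) : ∑ i, wcP2 n i = n * (n + 2) := by
  have h := Fin.sum_univ_eq_sum_range (fun i => if i < n then i + 2 else 2 * n - i) (2 * n)
  simp only [wcP2]
  rw [h, two_mul, Finset.sum_range_add, ← Finset.sum_add_distrib,
    Finset.sum_congr rfl (g := fun _ => n + 2)]
  · simp
  · intro i hi
    rw [Finset.mem_range] at hi
    rw [if_pos hi, if_neg (by omega)]
    omega

/-- Along the identity sequence, the machine 1 load up to and including job `m` exceeds the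
machine 2 load strictly before job `m` by exactly one. -/
theorem sum_range_wc (n m : ℕ) (hm : m < 2 * n) :
    ∑ i ∈ Finset.range (m + 1), (if i < n then i + 1 else 2 * n - i + 1) =
      ∑ i ∈ Finset.range m, (if i < n then i + 2 else 2 * n - i) + 1 := by
  induction m with
  | zero => simp
  | succ m ih =>
    rw [Finset.sum_range_succ, ih (by omega), Finset.sum_range_succ]
    split_ifs <;> omega

/-- Every position of the identity sequence is critical. -/
theorem wc_identity_path (n : ℕ) (k : Fin (2 * n)) :
    (∑ i ∈ Finset.Iic k, wcP1 n i) + ∑ i ∈ Finset.Ici k, wcP2 n i = (n + 1) ^ 2 := by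
  have h1 : ∑ i ∈ Finset.Iic k, wcP1 n i =
      ∑ i ∈ Finset.range (k.val + 1), (if i < n then i + 1 else 2 * n - i + 1) := by
    rw [Nat.range_succ_eq_Iic, ← Fin.map_valEmbedding_Iic, Finset.sum_map]
    rfl
  have h2 : ∑ i ∈ Finset.Iio k, wcP2 n i =
      ∑ i ∈ Finset.range k.val, (if i < n then i + 2 else 2 * n - i) := by
    rw [← Nat.Iio_eq_range, ← Fin.map_valEmbedding_Iio, Finset.sum_map]
    rfl
  have h3 : ∑ i ∈ Finset.Iio k, wcP2 n i + ∑ i ∈ Finset.Ici k, wcP2 n i = n * (n + 2) := by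
    rw [← sum_wcP2, ← Finset.sum_filter_add_sum_filter_not Finset.univ (· < k)]
    congr 2 <;> ext <;> simp
  rw [h1, sum_range_wc n k k.isLt, ← h2]
  linarith

/-- Worst-case family, optimal value: the identity sequence `1, 2, …, 2n` has
makespan `(n + 1)²`, and every permutation has makespan at least `(n + 1)²`. -/
theorem flowshop_worst_case_optimal_value (n : ℕ) (hn : 0 < n) :
    Cmax (2 * n) (wcP1 n) (wcP2 n) 1 = (n + 1) ^ 2 ∧
      ∀ π : Equiv.Perm (Fin (2 * n)), (n + 1) ^ 2 ≤ Cmax (2 * n) (wcP1 n) (wcP2 n) π := by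
  let z : Fin (2 * n) := ⟨0, by omega⟩
  constructor
  · simp only [Cmax, Equiv.Perm.one_apply, wc_identity_path]
    exact Finset.sup_const ⟨z, Finset.mem_univ z⟩ _
  · intro π
    refine le_trans ?_ (Finset.le_sup (Finset.mem_univ z))
    have h1 : 1 ≤ ∑ i ∈ Finset.Iic z, wcP1 n (π i) := by
      refine le_trans ?_ (Finset.single_le_sum (fun _ _ => Nat.zero_le _)
        (Finset.mem_Iic.2 (le_refl z)))
      simp only [wcP1]
      split_ifs <;> omega
    have h2 : Finset.Ici z = Finset.univ := by
      ext i
      simp [z, Fin.le_def]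
    rw [h2, Equiv.sum_comp π (wcP2 n), sum_wcP2]
    linarith
end

section
/- Worst-case family, uniqueness: fix n ≥ 1 and consider the two-machine flow shop with 2n jobs where p1(j) = j and p2(j) = j + 1 for 1 ≤ j ≤ n, and p1(j) = 2n − j + 2 and p2(j) = 2n − j + 1 for n + 1 ≤ j ≤ 2n. Then the identity sequence 1, 2, …, 2n is the unique optimal sequence: every permutation π different from the identity satisfies Cmax(π) > (n + 1)². In particular, for this instance a complete sorting of both Johnson sets A = {1, …, n} and B = {n + 1, …, 2n} is necessary to reach the optimum. -/
/-- The difference `p2 − p1`, which is `1` on Johnson's set A and `-1` on Johnson's set B. -/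
theorem wcP2_sub_wcP1 (n : ℕ) (i : Fin (2 * n)) :
    (wcP2 n i : ℤ) - wcP1 n i = if i.val < n then 1 else -1 := by
  unfold wcP1 wcP2
  split_ifs <;> omega

/-- The makespan terms, written through the lead of A-jobs over B-jobs before position `k`. -/
theorem makespan_term_eq (n : ℕ) (π : Equiv.Perm (Fin (2 * n))) (k : Fin (2 * n)) :
    (((∑ i ∈ Finset.Iic k, wcP1 n (π i)) + ∑ i ∈ Finset.Ici k, wcP2 n (π i) : ℕ) : ℤ) =
      n * (n + 2) + wcP1 n (π k) - ∑ i ∈ Finset.Iio k, if (π i).val < n then (1 : ℤ) else -1 := by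
  have total : ∑ i ∈ Finset.Iio k, (wcP2 n (π i) : ℤ) + ∑ i ∈ Finset.Ici k, (wcP2 n (π i) : ℤ) =
      n * (n + 2) := by
    have hcompl : Finset.Ici k = (Finset.Iio k)ᶜ := by ext; simp
    rw [hcompl, Finset.sum_add_sum_compl, Equiv.sum_comp π (fun i => (wcP2 n i : ℤ))]
    exact_mod_cast sum_wcP2 n
  have lead := Finset.sum_congr (rfl : Finset.Iio k = Finset.Iio k)
    fun i _ => wcP2_sub_wcP1 n (π i)
  rw [Finset.sum_sub_distrib] at lead
  rw [← Finset.Iio_insert, Finset.sum_insert (by simp), ← lead]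
  push_cast
  linarith

theorem sum_Iio_eq_of_sign_change {N : ℕ} (k : Fin N) (f : Fin N → ℤ) {m : ℕ} (hm : m ≤ k.val)
    (hpos : ∀ i < k, i.val < m → f i = 1) (hneg : ∀ i < k, m ≤ i.val → f i = -1) :
    ∑ i ∈ Finset.Iio k, f i = 2 * m - k := by
  have h : ∑ i ∈ Finset.Iio k, f i =
      ∑ i ∈ (Finset.Iio k).map Fin.valEmbedding, if i < m then (1 : ℤ) else -1 := by
    rw [Finset.sum_map]
    refine Finset.sum_congr rfl fun i hi => ?_
    rw [Finset.mem_Iio] at hi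
    by_cases him : i.val < m
    · simp [him, hpos i hi him]
    · simp [him, hneg i hi (not_lt.mp him)]
  rw [h, Fin.map_valEmbedding_Iio, Nat.Iio_eq_range]
  generalize k.val = q at hm
  induction q, hm using Nat.le_induction with
  | base =>
    rw [Finset.sum_congr rfl fun i hi => if_pos (Finset.mem_range.mp hi)]
    simp
    ring
  | succ q hq ih =>
    rw [Finset.sum_range_succ, ih, if_neg (not_lt.mpr hq)]
    push_cast
    ring

theorem perm_eq_one_of_le_apply {N : ℕ} (π : Equiv.Perm (Fin N)) (h : ∀ i, i ≤ π i) : π = 1 := by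
  have hsum : ∑ i : Fin N, i.val = ∑ i, (π i).val :=
    (Equiv.sum_comp π (fun i : Fin N => i.val)).symm
  have heq := (Finset.sum_eq_sum_iff_of_le fun i _ => Fin.le_def.mp (h i)).mp hsum
  exact Equiv.ext fun i => Fin.ext (heq i (Finset.mem_univ i)).symm

/-- If the lead of A-jobs over B-jobs before each position bounds the next `p1`, then the A-jobs
come first and in increasing order. -/
theorem apply_eq_self_of_wcP1_le_lead {n : ℕ} {π : Equiv.Perm (Fin (2 * n))}
    (hπ : ∀ k, (wcP1 n (π k) : ℤ) ≤
      (∑ i ∈ Finset.Iio k, if (π i).val < n then (1 : ℤ) else -1) + 1)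
    (j : Fin (2 * n)) (hj : j.val < n) : π j = j := by
  induction j using WellFoundedLT.induction with
  | ind j ih =>
  have fixed : ∀ i < j, π i = i := fun i hi => ih i hi (lt_trans hi hj)
  have ge_of_le : ∀ i, j ≤ i → j ≤ π i := by
    intro i hi
    by_contra! hlt
    have := π.injective (fixed _ hlt)
    rw [this] at hlt
    exact absurd hi (not_le.mpr hlt)
  have hex : ∃ q, j ≤ q ∧ (π q).val < n := by
    refine ⟨π.symm j, ?_, by simpa using hj⟩
    by_contra! hlt
    have := fixed _ hlt
    rw [Equiv.apply_symm_apply] at this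
    exact absurd this hlt.ne'
  obtain ⟨q, ⟨hjq, hq⟩, hmin⟩ := WellFounded.has_min (wellFounded_lt (α := Fin (2 * n)))
    {q | j ≤ q ∧ (π q).val < n} hex
  have lead := sum_Iio_eq_of_sign_change q (fun i => if (π i).val < n then (1 : ℤ) else -1)
    (m := j.val) hjq
    (fun i _ hij => if_pos (by rw [fixed i hij]; exact lt_trans hij hj))
    (fun i hiq hij => if_neg fun hi => hmin i ⟨hij, hi⟩ hiq)
  have hle := hπ q
  have hge := Fin.le_def.mp (ge_of_le q hjq)
  rw [lead, wcP1, if_pos hq] at hle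
  have hjq' := Fin.le_def.mp hjq
  have hqj : q = j := Fin.ext (by omega)
  subst hqj
  exact Fin.ext (by omega)

theorem eq_one_of_wcP1_le_lead {n : ℕ} {π : Equiv.Perm (Fin (2 * n))}
    (hπ : ∀ k, (wcP1 n (π k) : ℤ) ≤
      (∑ i ∈ Finset.Iio k, if (π i).val < n then (1 : ℤ) else -1) + 1) : π = 1 := by
  have fixed := apply_eq_self_of_wcP1_le_lead hπ
  have ge_of_ge : ∀ i : Fin (2 * n), n ≤ i.val → n ≤ (π i).val := by
    intro i hi
    by_contra! hlt
    rw [π.injective (fixed _ hlt)] at hlt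
    omega
  refine perm_eq_one_of_le_apply π fun k => ?_
  rcases lt_or_ge k.val n with hk | hk
  · exact (fixed k hk).ge
  · have lead := sum_Iio_eq_of_sign_change k (fun i => if (π i).val < n then (1 : ℤ) else -1) hk
      (fun i _ hi => if_pos (by rwa [fixed i hi]))
      (fun i _ hi => if_neg (not_lt.mpr (ge_of_ge i hi)))
    have hle := hπ k
    rw [lead, wcP1, if_neg (not_lt.mpr (ge_of_ge k hk))] at hle
    have := (π k).isLt
    rw [Fin.le_def]
    omega

/-- Worst-case family, uniqueness: the identity sequence `1, 2, …, 2n` is the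
unique optimal sequence; every other permutation has makespan strictly greater
than `(n + 1)²`. Hence a complete sorting of both Johnson sets is necessary. -/
theorem flowshop_worst_case_unique_optimum (n : ℕ) (hn : 0 < n) :
    ∀ π : Equiv.Perm (Fin (2 * n)), π ≠ 1 →
      (n + 1) ^ 2 < Cmax (2 * n) (wcP1 n) (wcP2 n) π := by
  intro π hne
  by_contra! hle
  refine hne (eq_one_of_wcP1_le_lead fun k => ?_)
  have hterm := makespan_term_eq n π k
  have hk := Int.ofNat_le.mpr ((Finset.sup_le_iff.mp hle) k (Finset.mem_univ k))
  rw [hterm, Nat.cast_pow, Nat.cast_succ] at hk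
  linarith
end
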